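/- Let n ≥ 1 be an integer, let w ∈ 𝔻, let ψ₀ and ψₙ be analytic functions on 𝔻, and let φ₀ and φₙ be analytic self-maps of 𝔻 with φ₀(w) = w and φₙ(w) = w. Suppose ψₙ has a zero at w of order at least n. Let f be analytic on 𝔻, let l ≥ n be an integer, and suppose f⁽ʲ⁾(w) = 0 for all 0 ≤ j ≤ l−1. Then the l-th derivative of z ↦ ψ₀(z)·f(φ₀(z)) + ψₙ(z)·f⁽ⁿ⁾(φₙ(z)) at the point w equals (ψ₀(w)·(φ₀′(w))^l + C(l,n)·ψₙ⁽ⁿ⁾(w)·(φₙ′(w))^{l−n})·f⁽ˡ⁾(w), where C(l,n) denotes the binomial coefficient, and where (φₙ′(w))^{l−n} is interpreted as 1 when l = n (convention 0⁰ = 1). -/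

import Mathlib

open Filter Topology

/-- If `h` agrees near `w` with `(z - w) ^ m * g z`, then `h⁽ᵐ⁾ w = m! * g w`. -/
theorem iteratedDeriv_eq_factorial_mul_of_eventuallyEq {m : ℕ} {w : ℂ} {h g : ℂ → ℂ}
    (hg : AnalyticAt ℂ g w) (hh : h =ᶠ[𝓝 w] fun z => (z - w) ^ m * g z) :
    iteratedDeriv m h w = m.factorial * g w := by
  have hpow (i : ℕ) : iteratedDeriv i (fun z : ℂ => (z - w) ^ m) w =
      ((if i = m then m.factorial else 0 : ℕ) : ℂ) := by
    have := congrFun (iteratedDeriv_comp_sub_const i (fun z : ℂ => z ^ m) w) w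
    simpa only [sub_self, iteratedDeriv_fun_pow_zero] using this
  rw [hh.iteratedDeriv_eq m, iteratedDeriv_fun_mul (AnalyticAt.contDiffAt (by fun_prop))
    hg.contDiffAt, Finset.sum_eq_single m]
  · simp [hpow]
  · intro i _ hi
    simp [hpow, hi]
  · simp

/-- A function analytic at `w` whose first `m` derivatives vanish there factors through
`(z - w) ^ m`, and the cofactor at `w` is determined by the `m`-th derivative. -/
theorem AnalyticAt.exists_eventuallyEq_sub_pow_mul {m : ℕ} {w : ℂ} {h : ℂ → ℂ}
    (hh : AnalyticAt ℂ h w) (hzero : ∀ k < m, iteratedDeriv k h w = 0) :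
    ∃ g : ℂ → ℂ, AnalyticAt ℂ g w ∧ (h =ᶠ[𝓝 w] fun z => (z - w) ^ m * g z) ∧
      iteratedDeriv m h w = m.factorial * g w := by
  obtain ⟨g, hg, hhg⟩ := (natCast_le_analyticOrderAt hh).1
    ((natCast_le_analyticOrderAt_iff_iteratedDeriv_eq_zero hh).2 hzero)
  exact ⟨g, hg, hhg, iteratedDeriv_eq_factorial_mul_of_eventuallyEq hg hhg⟩

/-- Composing a function that vanishes to order `m` at `w` with an analytic map fixing `w`. -/
theorem AnalyticAt.exists_comp_eventuallyEq_sub_pow_mul {m : ℕ} {w : ℂ} {h φ : ℂ → ℂ}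
    (hh : AnalyticAt ℂ h w) (hzero : ∀ k < m, iteratedDeriv k h w = 0)
    (hφ : AnalyticAt ℂ φ w) (hfix : φ w = w) :
    ∃ g : ℂ → ℂ, AnalyticAt ℂ g w ∧ (∀ᶠ z in 𝓝 w, h (φ z) = (z - w) ^ m * g z) ∧
      m.factorial * g w = deriv φ w ^ m * iteratedDeriv m h w := by
  obtain ⟨g, hg, hhg, hgw⟩ := hh.exists_eventuallyEq_sub_pow_mul hzero
  obtain ⟨q, hq, hφq, hqw⟩ :=
    (hφ.fun_sub (analyticAt_const (v := w))).exists_eventuallyEq_sub_pow_mul (m := 1) (by simp [hfix])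
  have hqw' : deriv φ w = q w := by simpa using hqw
  have hgφ : AnalyticAt ℂ (fun z => g (φ z)) w := AnalyticAt.fun_comp (by rwa [hfix]) hφ
  refine ⟨fun z => q z ^ m * g (φ z), (hq.fun_pow m).fun_mul hgφ, ?_, ?_⟩
  · have hlim : Tendsto φ (𝓝 w) (𝓝 w) := by simpa [hfix] using hφ.continuousAt.tendsto
    filter_upwards [hlim.eventually hhg, hφq] with z hz hz'
    rw [hz, hz', pow_one, mul_pow, mul_assoc]
  · simp only [hgw, hqw', hfix]
    ring

/-- Step in Proposition 3: if `f` vanishes at `w` to order `l ≥ n`, then the `l`-th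
derivative of `z ↦ ψ₀ z * f (φ₀ z) + ψₙ z * f⁽ⁿ⁾ (φₙ z)` at `w` equals
`(ψ₀ w * (φ₀' w)^l + C(l,n) * ψₙ⁽ⁿ⁾ w * (φₙ' w)^(l-n)) * f⁽ˡ⁾ w`. -/
theorem stmt_3 (n l : ℕ) (hn : 1 ≤ n) (hl : n ≤ l)
    (w : ℂ) (hw : w ∈ Metric.ball (0 : ℂ) 1)
    (ψ₀ ψₙ φ₀ φₙ : ℂ → ℂ)
    (hψ₀ : DifferentiableOn ℂ ψ₀ (Metric.ball 0 1))
    (hψₙ : DifferentiableOn ℂ ψₙ (Metric.ball 0 1))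
    (hφ₀ : DifferentiableOn ℂ φ₀ (Metric.ball 0 1))
    (hφₙ : DifferentiableOn ℂ φₙ (Metric.ball 0 1))
    (hφ₀m : Set.MapsTo φ₀ (Metric.ball 0 1) (Metric.ball 0 1))
    (hφₙm : Set.MapsTo φₙ (Metric.ball 0 1) (Metric.ball 0 1))
    (hfix₀ : φ₀ w = w) (hfixₙ : φₙ w = w)
    (hzero : ∀ k < n, iteratedDeriv k ψₙ w = 0)
    (f : ℂ → ℂ) (hf : DifferentiableOn ℂ f (Metric.ball 0 1))
    (hfzero : ∀ j < l, iteratedDeriv j f w = 0) :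
    iteratedDeriv l (fun z => ψ₀ z * f (φ₀ z) + ψₙ z * iteratedDeriv n f (φₙ z)) w
      = (ψ₀ w * (deriv φ₀ w) ^ l
          + (l.choose n : ℂ) * iteratedDeriv n ψₙ w * (deriv φₙ w) ^ (l - n))
        * iteratedDeriv l f w := by
  have hU : Metric.ball (0 : ℂ) 1 ∈ 𝓝 w := Metric.isOpen_ball.mem_nhds hw
  have aψ₀ := hψ₀.analyticAt hU
  have aψₙ := hψₙ.analyticAt hU
  have aφ₀ := hφ₀.analyticAt hU
  have aφₙ := hφₙ.analyticAt hU
  have af := hf.analyticAt hU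
  have hiter (k : ℕ) : iteratedDeriv k (iteratedDeriv n f) = iteratedDeriv (k + n) f := by
    simp only [iteratedDeriv_eq_iterate, Function.iterate_add_apply]
  have afn : AnalyticAt ℂ (iteratedDeriv n f) w := by
    rw [iteratedDeriv_eq_iterate]
    exact af.iterated_deriv n
  obtain ⟨g, hg, hfg, hgw⟩ := af.exists_comp_eventuallyEq_sub_pow_mul hfzero aφ₀ hfix₀
  obtain ⟨p, hp, hψp, hpw⟩ := aψₙ.exists_eventuallyEq_sub_pow_mul hzero
  obtain ⟨r, hr, hfr, hrw⟩ := afn.exists_comp_eventuallyEq_sub_pow_mul (m := l - n)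
    (fun k hk => by rw [hiter]; exact hfzero _ (by lia)) aφₙ hfixₙ
  rw [hiter, Nat.sub_add_cancel hl] at hrw
  rw [iteratedDeriv_eq_factorial_mul_of_eventuallyEq (g := fun z => ψ₀ z * g z + p z * r z)
    ((aψ₀.fun_mul hg).fun_add (hp.fun_mul hr)), hpw]
  · have hfac : (l.factorial : ℂ) = l.choose n * n.factorial * (l - n).factorial := by
      exact_mod_cast (Nat.choose_mul_factorial_mul_factorial hl).symm
    linear_combination ψ₀ w * hgw + l.choose n * n.factorial * p w * hrw + p w * r w * hfac
  · filter_upwards [hfg, hψp, hfr] with z h₁ h₂ h₃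
    rw [h₁, h₂, h₃, ← Nat.add_sub_cancel' hl, pow_add, Nat.add_sub_cancel_left]
    ring
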